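/- arXiv:1610.07369 — 2 statements merged into one kernel-verified Lean document; each statement's English description precedes it below -/
import Mathlib

section
/- (Lions' Lemma in BV) Suppose (u_n) is a bounded sequence in BV(ℝ^N) and there exist R > 0 and 1 ≤ q < N/(N-1) such that sup_{y ∈ ℝ^N} ∫_{B_R(y)} |u_n|^q dx → 0 as n → ∞. Then u_n → 0 strongly in L^s(ℝ^N) for every s ∈ (1, N/(N-1)). -/
open MeasureTheory Metric Set Filter

noncomputable section

def divg {N : ℕ} (φ : EuclideanSpace ℝ (Fin N) → EuclideanSpace ℝ (Fin N))
    (x : EuclideanSpace ℝ (Fin N)) : ℝ :=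
  ∑ i, fderiv ℝ (fun y => φ y i) x (EuclideanSpace.single i 1)

/-- The set of values `∫ u · div φ` over admissible test fields `φ`. -/
def divSet {N : ℕ} (u : EuclideanSpace ℝ (Fin N) → ℝ) : Set ℝ :=
  {r | ∃ φ : EuclideanSpace ℝ (Fin N) → EuclideanSpace ℝ (Fin N),
    ContDiff ℝ 1 φ ∧ HasCompactSupport φ ∧ (∀ x, ‖φ x‖ ≤ 1) ∧
    r = ∫ x, u x * divg φ x}

/-- `u ∈ BV(ℝᴺ)`: integrable with finite total variation. -/
def IsBV {N : ℕ} (u : EuclideanSpace ℝ (Fin N) → ℝ) : Prop :=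
  Integrable u ∧ BddAbove (divSet u)

/-- Total variation `∫ |Du|`. -/
def totalVar {N : ℕ} (u : EuclideanSpace ℝ (Fin N) → ℝ) : ℝ := sSup (divSet u)

/-- BV norm `∫|Du| + ∫|u|`. -/
def bvNorm {N : ℕ} (u : EuclideanSpace ℝ (Fin N) → ℝ) : ℝ :=
  totalVar u + ∫ x, |u x|

def IsRadial {N : ℕ} (u : EuclideanSpace ℝ (Fin N) → ℝ) : Prop :=
  ∀ x y : EuclideanSpace ℝ (Fin N), ‖x‖ = ‖y‖ → u x = u y

/-- Duality: the `L¹` norm is controlled by pairings with `C¹` compactly supported functions. -/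
lemma integral_abs_le_of_forall_integral_mul_le {E : Type*} [NormedAddCommGroup E]
    [NormedSpace ℝ E] [FiniteDimensional ℝ E] [MeasurableSpace E] [BorelSpace E]
    {μ : Measure E} [IsFiniteMeasureOnCompacts μ] {f : E → ℝ} (hf : Integrable f μ) {M : ℝ}
    (h : ∀ ψ : E → ℝ, ContDiff ℝ 1 ψ → HasCompactSupport ψ → (∀ x, |ψ x| ≤ 1) →
      ∫ x, f x * ψ x ∂μ ≤ M) :
    ∫ x, |f x| ∂μ ≤ M := by
  refine le_of_forall_pos_le_add fun ε hε => ?_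
  obtain ⟨g, hgc, hgs, hg⟩ := (memLp_one_iff_integrable.2 hf).exist_eLpNorm_sub_le
    ENNReal.one_ne_top le_rfl (half_pos hε)
  have hgi : Integrable g μ := hgs.continuous.integrable_of_hasCompactSupport hgc
  have hfg : ∫ x, |f x - g x| ∂μ ≤ ε / 2 := by
    rw [eLpNorm_one_eq_lintegral_enorm, ← ofReal_integral_norm_eq_lintegral_enorm (hf.sub hgi),
      ENNReal.ofReal_le_ofReal_iff (half_pos hε).le] at hg
    simpa using hg
  have hsqrt : ∀ (a : ℝ), 0 < a → ∀ t : ℝ, |t / √(t ^ 2 + a ^ 2)| ≤ 1 := by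
    intro a ha t
    have h0 : 0 < √(t ^ 2 + a ^ 2) := Real.sqrt_pos.2 (by positivity)
    rw [abs_div, abs_of_pos h0, div_le_one h0]
    exact Real.abs_le_sqrt (by nlinarith [sq_nonneg a])
  have key : ∀ n : ℕ, ∫ x, g x * (g x / √(g x ^ 2 + (1 / ((n : ℝ) + 1)) ^ 2)) ∂μ ≤ M + ε / 2 := by
    intro n
    set a : ℝ := 1 / ((n : ℝ) + 1) with ha
    have ha0 : 0 < a := by positivity
    set ψ : E → ℝ := fun x => g x / √(g x ^ 2 + a ^ 2) with hψ
    have hg1 : ContDiff ℝ 1 g := hgs.of_le (by exact_mod_cast le_top)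
    have hpos : ∀ x, g x ^ 2 + a ^ 2 ≠ 0 := fun x => by positivity
    have hψ1 : ContDiff ℝ 1 ψ :=
      hg1.div (((hg1.pow 2).add contDiff_const).sqrt hpos)
        fun x => (Real.sqrt_pos.2 (by positivity)).ne'
    have hψb : ∀ x, |ψ x| ≤ 1 := fun x => hsqrt a ha0 (g x)
    have hψc : HasCompactSupport ψ := hgc.mono fun x hx hgx => hx (by simp [hψ, hgx])
    have hψm : AEStronglyMeasurable ψ μ := hψ1.continuous.aestronglyMeasurable
    have hfψ : Integrable (fun x => f x * ψ x) μ := hf.mul_bdd hψm (.of_forall hψb)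
    have hdψ : Integrable (fun x => (g x - f x) * ψ x) μ :=
      (hgi.sub hf).mul_bdd hψm (.of_forall hψb)
    calc ∫ x, g x * ψ x ∂μ = ∫ x, f x * ψ x ∂μ + ∫ x, (g x - f x) * ψ x ∂μ := by
          rw [← integral_add hfψ hdψ]; congr 1; ext x; ring
      _ ≤ M + ∫ x, |f x - g x| ∂μ := by
          refine add_le_add (h ψ hψ1 hψc hψb) (integral_mono hdψ (hf.sub hgi).abs fun x => ?_)
          calc (g x - f x) * ψ x ≤ |(g x - f x) * ψ x| := le_abs_self _
            _ = |f x - g x| * |ψ x| := by rw [abs_mul, abs_sub_comm]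
            _ ≤ |f x - g x| := mul_le_of_le_one_right (abs_nonneg _) (hψb x)
      _ ≤ M + ε / 2 := by gcongr
  have hlim : Tendsto (fun n : ℕ => ∫ x, g x * (g x / √(g x ^ 2 + (1 / ((n : ℝ) + 1)) ^ 2)) ∂μ)
      atTop (nhds (∫ x, |g x| ∂μ)) := by
    refine tendsto_integral_of_dominated_convergence (fun x => |g x|) (fun n => ?_) hgi.abs
      (fun n => .of_forall fun x => ?_) (.of_forall fun x => ?_)
    · have := hgs.continuous
      refine Continuous.aestronglyMeasurable (this.mul (this.div (by fun_prop) fun x => ?_))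
      exact (Real.sqrt_pos.2 (by positivity)).ne'
    · rw [norm_mul, Real.norm_eq_abs, Real.norm_eq_abs]
      exact mul_le_of_le_one_right (abs_nonneg _) (hsqrt _ (by positivity) _)
    · by_cases hx : g x = 0
      · simp [hx]
      have h1 : Tendsto (fun n : ℕ => g x ^ 2 + (1 / ((n : ℝ) + 1)) ^ 2) atTop
          (nhds (g x ^ 2 + 0 ^ 2)) := (tendsto_one_div_add_atTop_nhds_zero_nat.pow 2).const_add _
      have h2 := (tendsto_const_nhds (x := g x)).mul ((tendsto_const_nhds (x := g x)).div
        ((Real.continuous_sqrt.tendsto _).comp h1) (by simpa [Real.sqrt_sq_eq_abs] using hx))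
      have h3 : g x * (g x / √(g x ^ 2 + 0 ^ 2)) = |g x| := by
        have : |g x| ≠ 0 := abs_ne_zero.2 hx
        rw [zero_pow two_ne_zero, add_zero, Real.sqrt_sq_eq_abs]
        field_simp
        exact (sq_abs _).symm
      rwa [h3] at h2
  have hgM := le_of_tendsto' hlim key
  calc ∫ x, |f x| ∂μ ≤ ∫ x, (|g x| + |f x - g x|) ∂μ := by
        refine integral_mono hf.abs (hgi.abs.add (hf.sub hgi).abs) fun x => ?_
        simpa using abs_add_le (g x) (f x - g x)
    _ = ∫ x, |g x| ∂μ + ∫ x, |f x - g x| ∂μ := integral_add hgi.abs (hf.sub hgi).abs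
    _ ≤ M + ε := by linarith

lemma IsBV.integral_mul_fderiv_le {N : ℕ} {u : EuclideanSpace ℝ (Fin N) → ℝ} (hu : IsBV u)
    {ψ : EuclideanSpace ℝ (Fin N) → ℝ} (hψ : ContDiff ℝ 1 ψ) (hc : HasCompactSupport ψ)
    (hb : ∀ x, |ψ x| ≤ 1) (h : EuclideanSpace ℝ (Fin N)) :
    ∫ x, u x * fderiv ℝ ψ x h ≤ totalVar u * ‖h‖ := by
  by_cases hh : h = 0
  · simp [hh]
  have hn : 0 < ‖h‖ := norm_pos_iff.2 hh
  have hmem : (∫ x, u x * fderiv ℝ ψ x h) * ‖h‖⁻¹ ∈ divSet u := by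
    refine ⟨fun x => ψ x • (‖h‖⁻¹ • h), hψ.smul contDiff_const, hc.smul_right, fun x => ?_, ?_⟩
    · simpa [norm_smul, hn.ne'] using hb x
    · rw [← integral_mul_const]
      congr 1
      ext x
      have hsum : ∑ i, h i • EuclideanSpace.single i (1 : ℝ) = h := by
        simpa using (EuclideanSpace.basisFun (Fin N) ℝ).sum_repr h
      have hd : ∀ i, fderiv ℝ (fun y => (ψ y • (‖h‖⁻¹ • h)) i) x (EuclideanSpace.single i 1)
          = fderiv ℝ ψ x (h i • EuclideanSpace.single i 1) * ‖h‖⁻¹ := by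
        intro i
        have : (fun y => (ψ y • (‖h‖⁻¹ • h)) i) = fun y => ψ y * (‖h‖⁻¹ * h i) := by
          ext y; simp
        rw [this, fderiv_mul_const (hψ.differentiable one_ne_zero x)]
        simp
        ring
      rw [divg, Finset.sum_congr rfl fun i _ => hd i, ← Finset.sum_mul, ← map_sum, hsum, mul_assoc]
  have := le_csSup hu.2 hmem
  rwa [← div_eq_mul_inv, div_le_iff₀ hn] at this

lemma IsBV.totalVar_nonneg {N : ℕ} {u : EuclideanSpace ℝ (Fin N) → ℝ} (hu : IsBV u) :
    0 ≤ totalVar u :=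
  le_csSup hu.2 ⟨0, contDiff_const, HasCompactSupport.zero, by simp, by simp [divg]⟩

/-- Translations are Lipschitz in `L¹` on `BV`. -/
lemma IsBV.integral_abs_translate_sub_le {N : ℕ} {u : EuclideanSpace ℝ (Fin N) → ℝ} (hu : IsBV u)
    (h : EuclideanSpace ℝ (Fin N)) :
    ∫ x, |u (x + h) - u x| ≤ totalVar u * ‖h‖ := by
  have huh : Integrable (fun x => u (x + h)) := hu.1.comp_add_right h
  refine integral_abs_le_of_forall_integral_mul_le (huh.sub hu.1) fun ψ hψ hc hb => ?_
  set F : ℝ → ℝ := fun t => ∫ x, u x * ψ (x - t • h) with hF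
  obtain ⟨K, hK⟩ := (hψ.continuous_fderiv one_ne_zero).bounded_above_of_compact_support
    (hc.fderiv ℝ)
  have hmeas : ∀ t : ℝ, AEStronglyMeasurable (fun x => u x * ψ (x - t • h)) volume := fun t =>
    hu.1.aestronglyMeasurable.mul
      (hψ.continuous.comp (by fun_prop : Continuous fun x : EuclideanSpace ℝ (Fin N) => x - t • h)).aestronglyMeasurable
  have hderiv : ∀ t, HasDerivAt F (∫ x, u x * -(fderiv ℝ ψ (x - t • h) h)) t := by
    intro t
    refine (hasDerivAt_integral_of_dominated_loc_of_deriv_le (s := univ)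
      (F' := fun s x => u x * -(fderiv ℝ ψ (x - s • h) h))
      (bound := fun x => |u x| * (K * ‖h‖)) univ_mem
      (.of_forall hmeas) ?_ ?_ ?_ (hu.1.abs.mul_const _) ?_).2
    · exact hu.1.mul_bdd (c := 1) (hψ.continuous.comp
        (by fun_prop : Continuous fun x : EuclideanSpace ℝ (Fin N) => x - t • h)).aestronglyMeasurable (.of_forall fun x => hb _)
    · refine hu.1.aestronglyMeasurable.mul (Continuous.aestronglyMeasurable ?_)
      have := hψ.continuous_fderiv one_ne_zero
      fun_prop
    · refine .of_forall fun x s _ => ?_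
      rw [norm_mul, norm_neg, Real.norm_eq_abs]
      gcongr
      exact (ContinuousLinearMap.le_opNorm _ _).trans (by gcongr; exact hK _)
    · refine .of_forall fun x s _ => ?_
      have h1 : HasDerivAt (fun s : ℝ => x - s • h) (-h) s := by
        simpa using ((hasDerivAt_id s).smul_const h).const_sub x
      have h2 := ((hψ.differentiable one_ne_zero (x - s • h)).hasFDerivAt.comp_hasDerivAt s h1)
      simpa using h2.const_mul (u x)
  have hbound : ∀ t : ℝ, ∫ x, u x * -(fderiv ℝ ψ (x - t • h) h) ≤ totalVar u * ‖h‖ := by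
    intro t
    have := hu.integral_mul_fderiv_le (ψ := fun x : EuclideanSpace ℝ (Fin N) => ψ (x - t • h))
      (by fun_prop)
      (hc.comp_homeomorph (Homeomorph.subRight (t • h))) (fun x => hb _) (-h)
    simpa [fderiv_comp_sub] using this
  have hFd : Differentiable ℝ F := fun t => (hderiv t).differentiableAt
  have := image_sub_le_mul_sub_of_deriv_le hFd (C := totalVar u * ‖h‖)
    (fun t => (hderiv t).deriv ▸ hbound t) zero_le_one
  have hF1 : F 1 = ∫ x, u (x + h) * ψ x := by
    rw [← integral_sub_right_eq_self (fun x => u (x + h) * ψ x) h]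
    simp [hF]
  have hF0 : F 0 = ∫ x, u x * ψ x := by simp [hF]
  have hψm := hψ.continuous.aestronglyMeasurable (μ := volume)
  simp only [Pi.sub_apply, sub_mul]
  rw [integral_sub (huh.mul_bdd hψm (.of_forall hb)) (hu.1.mul_bdd hψm (.of_forall hb)), ← hF1,
    ← hF0]
  simpa using this

section Mollify

open scoped Convolution
open ContinuousLinearMap

variable {E : Type*} [NormedAddCommGroup E] [NormedSpace ℝ E] [FiniteDimensional ℝ E]
  [HasContDiffBump E] [MeasurableSpace E] [BorelSpace E] {μ : Measure E} [μ.IsAddHaarMeasure]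

lemma ContDiffBump.lintegral_enorm_normed (φ : ContDiffBump (0 : E)) :
    ∫⁻ t, ‖φ.normed μ t‖ₑ ∂μ = 1 := by
  rw [← ofReal_integral_norm_eq_lintegral_enorm φ.integrable_normed]
  simp [abs_of_nonneg (φ.nonneg_normed _), φ.integral_normed]

lemma ContDiffBump.integrable_normed_mul_comp_sub (φ : ContDiffBump (0 : E)) {g : E → ℝ}
    (hg : Integrable g μ) (x : E) : Integrable (fun t => φ.normed μ t * g (x - t)) μ := by
  have hK : ∀ t, ‖φ.normed μ t‖ ≤ 1 / μ.real (closedBall 0 φ.rIn) := fun t => by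
    rw [Real.norm_of_nonneg (φ.nonneg_normed t)]
    exact φ.normed_le_div_measure_closedBall_rIn μ t
  exact (hg.comp_sub_left x).bdd_mul φ.continuous_normed.aestronglyMeasurable (.of_forall hK)

lemma ContDiffBump.lintegral_enorm_convolution_le (φ : ContDiffBump (0 : E)) {g : E → ℝ}
    (hg : Integrable g μ) :
    ∫⁻ x, ‖(φ.normed μ ⋆[lsmul ℝ ℝ, μ] g) x‖ₑ ∂μ ≤ ∫⁻ x, ‖g x‖ₑ ∂μ := by
  calc ∫⁻ x, ‖(φ.normed μ ⋆[lsmul ℝ ℝ, μ] g) x‖ₑ ∂μ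
      ≤ ∫⁻ x, ∫⁻ t, ‖φ.normed μ t • g (x - t)‖ₑ ∂μ ∂μ :=
        lintegral_mono fun x => enorm_integral_le_lintegral_enorm _
    _ = ∫⁻ t, ∫⁻ x, ‖φ.normed μ t • g (x - t)‖ₑ ∂μ ∂μ :=
        lintegral_lintegral_swap ((φ.continuous_normed.aestronglyMeasurable (μ := μ)
          |>.convolution_integrand (lsmul ℝ ℝ) hg.aestronglyMeasurable).enorm)
    _ = ∫⁻ t, ‖φ.normed μ t‖ₑ * ∫⁻ x, ‖g x‖ₑ ∂μ ∂μ := by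
        congr 1; ext t
        simp_rw [enorm_smul]
        rw [lintegral_const_mul' _ _ enorm_ne_top,
          lintegral_sub_right_eq_self (fun x => ‖g x‖ₑ) t]
    _ = ∫⁻ x, ‖g x‖ₑ ∂μ := by
        rw [lintegral_mul_const _ φ.continuous_normed.enorm.measurable, φ.lintegral_enorm_normed,
          one_mul]

lemma ContDiffBump.lintegral_enorm_sub_convolution_le (φ : ContDiffBump (0 : E)) {u : E → ℝ}
    (hu : Integrable u μ) {T : ENNReal} (hT : ∀ h, ∫⁻ x, ‖u (x + h) - u x‖ₑ ∂μ ≤ T * ‖h‖ₑ) :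
    ∫⁻ x, ‖u x - (φ.normed μ ⋆[lsmul ℝ ℝ, μ] u) x‖ₑ ∂μ ≤ T * ENNReal.ofReal φ.rOut := by
  have hmeas : AEStronglyMeasurable (fun p : E × E => φ.normed μ p.2 * (u (p.1 - p.2) - u p.1))
      (μ.prod μ) := by
    refine (φ.continuous_normed.comp continuous_snd).aestronglyMeasurable.mul (.sub ?_ ?_)
    · exact hu.aestronglyMeasurable.comp_quasiMeasurePreserving
        (quasiMeasurePreserving_sub_of_right_invariant μ μ)
    · exact hu.aestronglyMeasurable.comp_fst
  calc ∫⁻ x, ‖u x - (φ.normed μ ⋆[lsmul ℝ ℝ, μ] u) x‖ₑ ∂μ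
      = ∫⁻ x, ‖∫ t, φ.normed μ t * (u (x - t) - u x) ∂μ‖ₑ ∂μ := by
        congr 1; ext x
        simp_rw [mul_sub]
        rw [integral_sub (φ.integrable_normed_mul_comp_sub hu x) (φ.integrable_normed.mul_const _),
          integral_mul_const, φ.integral_normed, one_mul, enorm_sub_rev]
        rfl
    _ ≤ ∫⁻ x, ∫⁻ t, ‖φ.normed μ t * (u (x - t) - u x)‖ₑ ∂μ ∂μ :=
        lintegral_mono fun x => enorm_integral_le_lintegral_enorm _
    _ = ∫⁻ t, ∫⁻ x, ‖φ.normed μ t * (u (x - t) - u x)‖ₑ ∂μ ∂μ :=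
        lintegral_lintegral_swap hmeas.enorm
    _ ≤ ∫⁻ t, ‖φ.normed μ t‖ₑ * (T * ENNReal.ofReal φ.rOut) ∂μ := by
        refine lintegral_mono fun t => ?_
        simp_rw [enorm_mul]
        rw [lintegral_const_mul' _ _ enorm_ne_top]
        by_cases ht : t ∈ Function.support (φ.normed μ)
        · rw [φ.support_normed_eq, mem_ball_zero_iff] at ht
          gcongr
          refine le_trans (by simpa [sub_eq_add_neg] using hT (-t)) ?_
          gcongr
          rw [← ofReal_norm]
          exact ENNReal.ofReal_le_ofReal ht.le
        · simp [Function.notMem_support.1 ht]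
    _ = T * ENNReal.ofReal φ.rOut := by
        rw [lintegral_mul_const _ φ.continuous_normed.enorm.measurable, φ.lintegral_enorm_normed,
          one_mul]

lemma ContDiffBump.lintegral_enorm_convolution_translate_sub_le (φ : ContDiffBump (0 : E))
    {u : E → ℝ} (hu : Integrable u μ) (h : E) :
    ∫⁻ x, ‖(φ.normed μ ⋆[lsmul ℝ ℝ, μ] u) (x + h) - (φ.normed μ ⋆[lsmul ℝ ℝ, μ] u) x‖ₑ ∂μ ≤
      ∫⁻ x, ‖u (x + h) - u x‖ₑ ∂μ := by
  have huh : Integrable (fun x => u (x + h)) μ := hu.comp_add_right h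
  refine le_trans (le_of_eq ?_) (φ.lintegral_enorm_convolution_le (huh.sub hu))
  congr 1; ext x; congr 1
  have h1 := φ.integrable_normed_mul_comp_sub huh x
  have h2 := φ.integrable_normed_mul_comp_sub hu x
  simp only [convolution_lsmul, smul_eq_mul, mul_sub]
  rw [integral_sub h1 h2]
  simp_rw [sub_add_eq_add_sub]

lemma ContDiffBump.enorm_convolution_le (φ : ContDiffBump (0 : E)) {u : E → ℝ} {R : ℝ}
    (hR : φ.rOut ≤ R) (x : E) :
    ‖(φ.normed μ ⋆[lsmul ℝ ℝ, μ] u) x‖ₑ ≤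
      ENNReal.ofReal (1 / μ.real (closedBall 0 φ.rIn)) * ∫⁻ y in ball x R, ‖u y‖ₑ ∂μ := by
  calc ‖(φ.normed μ ⋆[lsmul ℝ ℝ, μ] u) x‖ₑ ≤ ∫⁻ t, ‖φ.normed μ t • u (x - t)‖ₑ ∂μ :=
        enorm_integral_le_lintegral_enorm _
    _ = ∫⁻ y, ‖φ.normed μ (x - y) • u y‖ₑ ∂μ := by
        rw [← lintegral_sub_left_eq_self _ x]
        simp
    _ ≤ ∫⁻ y, ENNReal.ofReal (1 / μ.real (closedBall 0 φ.rIn)) *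
          (ball x R).indicator (fun y => ‖u y‖ₑ) y ∂μ := by
        refine lintegral_mono fun y => ?_
        rw [enorm_smul]
        by_cases hy : y ∈ ball x R
        · rw [indicator_of_mem hy, ← ofReal_norm (φ.normed μ (x - y)),
            Real.norm_of_nonneg (φ.nonneg_normed _)]
          gcongr
          exact φ.normed_le_div_measure_closedBall_rIn μ _
        · have : x - y ∉ Function.support (φ.normed μ) := by
            rw [φ.support_normed_eq, mem_ball_zero_iff, not_lt, ← dist_eq_norm]
            rw [mem_ball', not_lt] at hy
            exact hR.trans hy
          simp [Function.notMem_support.1 this]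
    _ = _ := by
        rw [lintegral_const_mul' _ _ ENNReal.ofReal_ne_top, lintegral_indicator measurableSet_ball]

lemma ContDiffBump.contDiff_normed_convolution (φ : ContDiffBump (0 : E)) {u : E → ℝ}
    (hu : Integrable u μ) : ContDiff ℝ 1 (φ.normed μ ⋆[lsmul ℝ ℝ, μ] u) :=
  φ.hasCompactSupport_normed.contDiff_convolution_left (n := 1) _ φ.contDiff_normed
    hu.locallyIntegrable

end Mollify

/-- Passing to the limit in difference quotients. -/
lemma lintegral_enorm_fderiv_apply_le {E : Type*} [NormedAddCommGroup E] [NormedSpace ℝ E]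
    [MeasurableSpace E] [BorelSpace E] {μ : Measure E} {v : E → ℝ} (hv : ContDiff ℝ 1 v) {T : ENNReal}
    (hT : ∀ h, ∫⁻ x, ‖v (x + h) - v x‖ₑ ∂μ ≤ T * ‖h‖ₑ) (h : E) :
    ∫⁻ x, ‖fderiv ℝ v x h‖ₑ ∂μ ≤ T * ‖h‖ₑ := by
  have hc : Tendsto (fun n : ℕ => ‖((n : ℝ) + 1)‖) atTop atTop :=
    tendsto_norm_atTop_atTop.comp (tendsto_atTop_add_const_right _ _ tendsto_natCast_atTop_atTop)
  have hlim : ∀ x, Tendsto (fun n : ℕ => ‖((n : ℝ) + 1) • (v (x + ((n : ℝ) + 1)⁻¹ • h) - v x)‖ₑ)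
      atTop (nhds ‖fderiv ℝ v x h‖ₑ) := fun x =>
    ((hv.differentiable one_ne_zero x).hasFDerivAt.lim h hc).enorm
  have hvc := hv.continuous
  calc ∫⁻ x, ‖fderiv ℝ v x h‖ₑ ∂μ
      = ∫⁻ x, liminf (fun n : ℕ => ‖((n : ℝ) + 1) • (v (x + ((n : ℝ) + 1)⁻¹ • h) - v x)‖ₑ)
          atTop ∂μ := by
        congr 1; ext x; exact (hlim x).liminf_eq.symm
    _ ≤ liminf (fun n : ℕ => ∫⁻ x, ‖((n : ℝ) + 1) • (v (x + ((n : ℝ) + 1)⁻¹ • h) - v x)‖ₑ ∂μ)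
          atTop :=
        lintegral_liminf_le fun n => (by fun_prop : Continuous _).measurable
    _ ≤ liminf (fun _ : ℕ => T * ‖h‖ₑ) atTop := by
        refine liminf_le_liminf (.of_forall fun n => ?_)
        simp_rw [enorm_smul]
        rw [lintegral_const_mul' _ _ enorm_ne_top]
        refine (mul_le_mul_right (hT _) _).trans_eq ?_
        have h0 : (n : ℝ) + 1 ≠ 0 := by positivity
        rw [enorm_smul, mul_left_comm, ← mul_assoc ‖(n : ℝ) + 1‖ₑ, ← enorm_mul,
          mul_inv_cancel₀ h0]
        simp
    _ = T * ‖h‖ₑ := by simp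

lemma lintegral_enorm_fderiv_le {N : ℕ} {v : EuclideanSpace ℝ (Fin N) → ℝ}
    (hv : ContDiff ℝ 1 v) {T : ENNReal} (hT : ∀ h, ∫⁻ x, ‖v (x + h) - v x‖ₑ ≤ T * ‖h‖ₑ) :
    ∫⁻ x, ‖fderiv ℝ v x‖ₑ ≤ N * T := by
  have hle : ∀ L : EuclideanSpace ℝ (Fin N) →L[ℝ] ℝ,
      ‖L‖ₑ ≤ ∑ i, ‖L (EuclideanSpace.single i 1)‖ₑ := by
    intro L
    have : ‖L‖ ≤ ∑ i, ‖L (EuclideanSpace.single i 1)‖ := by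
      refine L.opNorm_le_bound (by positivity) fun h => ?_
      have hsum : ∑ i, h i • EuclideanSpace.single i (1 : ℝ) = h := by
        simpa using (EuclideanSpace.basisFun (Fin N) ℝ).sum_repr h
      calc ‖L h‖ = ‖∑ i, h i * L (EuclideanSpace.single i 1)‖ := by
            conv_lhs => rw [← hsum]
            simp
        _ ≤ ∑ i, ‖L (EuclideanSpace.single i 1)‖ * ‖h‖ := by
            refine norm_sum_le_of_le _ fun i _ => ?_
            rw [norm_mul, mul_comm]
            gcongr
            exact PiLp.norm_apply_le h i
        _ = _ := by rw [Finset.sum_mul]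
    simp only [← ofReal_norm]
    rw [← ENNReal.ofReal_sum_of_nonneg fun i _ => norm_nonneg _]
    exact ENNReal.ofReal_le_ofReal this
  have hc := hv.continuous_fderiv one_ne_zero
  calc ∫⁻ x, ‖fderiv ℝ v x‖ₑ
      ≤ ∫⁻ x, ∑ i, ‖fderiv ℝ v x (EuclideanSpace.single i 1)‖ₑ := lintegral_mono fun x => hle _
    _ = ∑ i, ∫⁻ x, ‖fderiv ℝ v x (EuclideanSpace.single i 1)‖ₑ :=
        lintegral_finsetSum _ fun i _ => (by fun_prop : Continuous _).measurable
    _ ≤ ∑ _i : Fin N, T := Finset.sum_le_sum fun i _ => by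
        have h1 : ‖EuclideanSpace.single i (1 : ℝ)‖ₑ = 1 := by rw [← ofReal_norm]; simp
        simpa [h1] using lintegral_enorm_fderiv_apply_le hv hT (EuclideanSpace.single i 1)
    _ = N * T := by simp

open Module in
/-- The Gagliardo–Nirenberg–Sobolev inequality without compact support. -/
lemma eLpNorm_le_eLpNorm_fderiv_one_of_integrable {E : Type*} [NormedAddCommGroup E]
    [NormedSpace ℝ E] [FiniteDimensional ℝ E] [HasContDiffBump E] [MeasurableSpace E]
    [BorelSpace E] {μ : Measure E} [μ.IsAddHaarMeasure] {v : E → ℝ} (hv : ContDiff ℝ 1 v)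
    (hvi : Integrable v μ) {p : NNReal} (hp : NNReal.HolderConjugate (finrank ℝ E) p) :
    eLpNorm v p μ ≤ eLpNormLESNormFDerivOneConst μ p * eLpNorm (fderiv ℝ v) 1 μ := by
  let χ : ContDiffBump (0 : E) := ⟨1, 2, one_pos, one_lt_two⟩
  have hχ : ContDiff ℝ 1 χ := χ.contDiff
  obtain ⟨K, hK⟩ := (hχ.continuous_fderiv one_ne_zero).bounded_above_of_compact_support
    (χ.hasCompactSupport.fderiv ℝ)
  have hK0 : 0 ≤ K := (norm_nonneg _).trans (hK 0)
  set c : ℕ → ℝ := fun n => 1 / ((n : ℝ) + 1) with hc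
  have hc0 : ∀ n, 0 < c n := fun n => by positivity
  set w : ℕ → E → ℝ := fun n x => χ (c n • x) * v x with hw
  have hχc : ∀ n, ContDiff ℝ 1 fun x => χ (c n • x) := fun n => by fun_prop
  have hw1 : ∀ n, ContDiff ℝ 1 (w n) := fun n => (hχc n).mul hv
  have hws : ∀ n, HasCompactSupport (w n) := fun n =>
    (χ.hasCompactSupport.comp_smul (hc0 n).ne').mul_right
  have hd : ∀ n x, ‖fderiv ℝ (w n) x‖ₑ ≤
      ‖fderiv ℝ v x‖ₑ + ENNReal.ofReal (c n * K) * ‖v x‖ₑ := by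
    intro n x
    have h1 : fderiv ℝ (w n) x = χ (c n • x) • fderiv ℝ v x +
        v x • (c n • fderiv ℝ χ (c n • x)) := by
      rw [hw, fderiv_fun_mul ((hχc n).differentiable one_ne_zero x)
        (hv.differentiable one_ne_zero x), fderiv_comp_smul]
    have h2 : ‖fderiv ℝ (w n) x‖ ≤ ‖fderiv ℝ v x‖ + c n * K * ‖v x‖ := by
      rw [h1]
      refine (norm_add_le _ _).trans (add_le_add ?_ ?_)
      · rw [norm_smul, Real.norm_of_nonneg χ.nonneg]
        exact mul_le_of_le_one_left (norm_nonneg _) χ.le_one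
      · rw [norm_smul, norm_smul, Real.norm_of_nonneg (hc0 n).le, mul_comm]
        have := (hc0 n).le
        gcongr
        exact hK _
    simp only [← ofReal_norm]
    rw [← ENNReal.ofReal_mul (by have := hc0 n; positivity), ← ENNReal.ofReal_add (by positivity)
      (by have := hc0 n; positivity)]
    exact ENNReal.ofReal_le_ofReal h2
  have hdi : ∀ n, eLpNorm (fderiv ℝ (w n)) 1 μ ≤
      eLpNorm (fderiv ℝ v) 1 μ + ENNReal.ofReal (c n * K) * eLpNorm v 1 μ := by
    intro n
    simp only [eLpNorm_one_eq_lintegral_enorm]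
    refine (lintegral_mono (hd n)).trans_eq ?_
    rw [lintegral_add_left (hv.continuous_fderiv one_ne_zero).enorm.measurable,
      lintegral_const_mul' _ _ ENNReal.ofReal_ne_top]
  have hclim : Tendsto c atTop (nhds 0) := tendsto_one_div_add_atTop_nhds_zero_nat
  have hlim : ∀ x, Tendsto (fun n => w n x) atTop (nhds (v x)) := by
    intro x
    have h1 : Tendsto (fun n => χ (c n • x)) atTop (nhds (χ ((0 : ℝ) • x))) :=
      (χ.continuous.tendsto _).comp (hclim.smul_const x)
    rw [zero_smul, χ.one_of_mem_closedBall (by simp [χ])] at h1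
    simpa using h1.mul_const (v x)
  have hrhs : Tendsto (fun n => eLpNormLESNormFDerivOneConst μ p *
      (eLpNorm (fderiv ℝ v) 1 μ + ENNReal.ofReal (c n * K) * eLpNorm v 1 μ)) atTop
      (nhds (eLpNormLESNormFDerivOneConst μ p * eLpNorm (fderiv ℝ v) 1 μ)) := by
    have hfin : eLpNorm v 1 μ ≠ ⊤ := (memLp_one_iff_integrable.2 hvi).eLpNorm_ne_top
    have h1 : Tendsto (fun n => ENNReal.ofReal (c n * K)) atTop (nhds 0) := by
      simpa using ENNReal.tendsto_ofReal (hclim.mul_const K)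
    have h2 := ENNReal.Tendsto.mul_const h1 (.inr hfin)
    simpa using ENNReal.Tendsto.const_mul (h2.const_add (eLpNorm (fderiv ℝ v) 1 μ))
      (.inr ENNReal.coe_ne_top)
  calc eLpNorm v p μ ≤ liminf (fun n => eLpNorm (w n) p μ) atTop :=
        Lp.eLpNorm_lim_le_liminf_eLpNorm (fun n => (hw1 n).continuous.aestronglyMeasurable) v
          (.of_forall hlim)
    _ ≤ liminf (fun n => eLpNormLESNormFDerivOneConst μ p *
      (eLpNorm (fderiv ℝ v) 1 μ + ENNReal.ofReal (c n * K) * eLpNorm v 1 μ)) atTop := by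
        refine liminf_le_liminf (.of_forall fun n => ?_)
        exact (eLpNorm_le_eLpNorm_fderiv_one μ (hw1 n) (hws n) hp).trans
          (mul_le_mul_right (hdi n) _)
    _ = _ := hrhs.liminf_eq

section Sobolev

open scoped Convolution
open ContinuousLinearMap Module

variable {N : ℕ} {u : EuclideanSpace ℝ (Fin N) → ℝ} {T : ENNReal} {p : NNReal}

lemma ContDiffBump.eLpNorm_convolution_le (φ : ContDiffBump (0 : EuclideanSpace ℝ (Fin N)))
    (hu : Integrable u) (hT : ∀ h, ∫⁻ x, ‖u (x + h) - u x‖ₑ ≤ T * ‖h‖ₑ)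
    (hp : NNReal.HolderConjugate N p) :
    eLpNorm (φ.normed volume ⋆[lsmul ℝ ℝ] u) p ≤
      eLpNormLESNormFDerivOneConst (volume : Measure (EuclideanSpace ℝ (Fin N))) p * (N * T) := by
  have hv := φ.contDiff_normed_convolution hu
  refine (eLpNorm_le_eLpNorm_fderiv_one_of_integrable hv
    (φ.integrable_normed.integrable_convolution _ hu) (by simpa using hp)).trans
      (mul_le_mul_right ?_ _)
  rw [eLpNorm_one_eq_lintegral_enorm]
  exact lintegral_enorm_fderiv_le hv fun h =>
    (φ.lintegral_enorm_convolution_translate_sub_le hu h).trans (hT h)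

/-- The Sobolev inequality for integrable functions with Lipschitz translations in `L¹`. -/
lemma eLpNorm_le_of_lintegral_translate_sub_le
    (hu : Integrable u) (hT : ∀ h, ∫⁻ x, ‖u (x + h) - u x‖ₑ ≤ T * ‖h‖ₑ)
    (hp : NNReal.HolderConjugate N p) :
    eLpNorm u p ≤
      eLpNormLESNormFDerivOneConst (volume : Measure (EuclideanSpace ℝ (Fin N))) p * (N * T) := by
  let φ : ℕ → ContDiffBump (0 : EuclideanSpace ℝ (Fin N)) := fun n =>
    ⟨1 / ((n : ℝ) + 1) / 2, 1 / ((n : ℝ) + 1), by positivity, half_lt_self (by positivity)⟩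
  have hlim := ContDiffBump.ae_convolution_tendsto_right_of_locallyIntegrable (φ := φ) (l := atTop)
    (K := 2) (μ := volume) tendsto_one_div_add_atTop_nhds_zero_nat
    (.of_forall fun n => by simp only [φ]; linarith) hu.locallyIntegrable
  refine (Lp.eLpNorm_lim_le_liminf_eLpNorm (fun n =>
    ((φ n).contDiff_normed_convolution hu).continuous.aestronglyMeasurable) u hlim).trans ?_
  refine (liminf_le_liminf (.of_forall fun n =>
    (φ n).eLpNorm_convolution_le hu hT hp)).trans_eq ?_
  simp

/-- Interpolation between `L¹` and `Lᵖ`. -/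
lemma lintegral_rpow_le_interpolate {α : Type*} [MeasurableSpace α] {μ : Measure α}
    {f : α → ENNReal} (hf : AEMeasurable f μ) {s p : ℝ} (hs : 1 ≤ s) (hsp : s < p) :
    ∫⁻ x, f x ^ s ∂μ ≤ (∫⁻ x, f x ∂μ) ^ ((p - s) / (p - 1)) *
      (∫⁻ x, f x ^ p ∂μ) ^ ((s - 1) / (p - 1)) := by
  have hp : 0 < p - 1 := by linarith
  have ha : 0 ≤ (p - s) / (p - 1) := div_nonneg (by linarith) hp.le
  have hb : 0 ≤ (s - 1) / (p - 1) := div_nonneg (by linarith) hp.le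
  refine le_trans (le_of_eq ?_) (ENNReal.lintegral_mul_norm_pow_le hf (hf.pow_const p) ha hb
    (by field_simp; ring))
  congr 1; ext x
  rw [← ENNReal.rpow_mul, ← ENNReal.rpow_add_of_nonneg _ _ ha (by nlinarith)]
  congr 1
  field_simp
  ring

lemma lintegral_enorm_rpow_le_of_eLpNorm_le {α : Type*} [MeasurableSpace α] {μ : Measure α}
    {f : α → ℝ} {p : NNReal} (hp : p ≠ 0) {A : ENNReal} (h : eLpNorm f p μ ≤ A) :
    ∫⁻ x, ‖f x‖ₑ ^ (p : ℝ) ∂μ ≤ A ^ (p : ℝ) := by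
  rw [← eLpNorm_nnreal_pow_eq_lintegral hp]
  gcongr

/-- Smoothing at scale `r` splits the `Lˢ` norm of a `BV` function into a part which is small
with `r` and a part controlled by the local `L¹` norms. -/
lemma lintegral_rpow_le_of_lintegral_ball_le
    (hu : Integrable u) (hT : ∀ h, ∫⁻ x, ‖u (x + h) - u x‖ₑ ≤ T * ‖h‖ₑ)
    (hp : NNReal.HolderConjugate N p) {s r R : ℝ} (hs : 1 < s) (hsp : s < p) (hr : 0 < r)
    (hrR : r ≤ R) {A D : ENNReal}
    (hA : eLpNormLESNormFDerivOneConst (volume : Measure (EuclideanSpace ℝ (Fin N))) p * (N * T)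
      ≤ A) (hD : ∀ x, ∫⁻ y in ball x R, ‖u y‖ₑ ≤ D) :
    ∫⁻ x, ‖u x‖ₑ ^ s ≤ 2 ^ (s - 1) *
      ((T * ENNReal.ofReal r) ^ ((p - s) / (p - 1)) *
        ((A + A) ^ (p : ℝ)) ^ ((s - 1) / (p - 1)) +
      (ENNReal.ofReal (1 / (volume : Measure (EuclideanSpace ℝ (Fin N))).real
        (closedBall 0 (r / 2))) * D) ^ (s - 1) * ∫⁻ x, ‖u x‖ₑ) := by
  let φ : ContDiffBump (0 : EuclideanSpace ℝ (Fin N)) := ⟨r / 2, r, half_pos hr, half_lt_self hr⟩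
  set v := φ.normed volume ⋆[lsmul ℝ ℝ] u
  have hvc : Continuous v := (φ.contDiff_normed_convolution hu).continuous
  have hum := hu.aestronglyMeasurable
  have hwm : AEStronglyMeasurable (fun x => u x - v x) volume := hum.sub hvc.aestronglyMeasurable
  have hp1 : 0 < (p : ℝ) - 1 := by linarith
  have hsmooth : ∫⁻ x, ‖u x - v x‖ₑ ^ s ≤ (T * ENNReal.ofReal r) ^ ((p - s) / (p - 1)) *
        ((A + A) ^ (p : ℝ)) ^ ((s - 1) / (p - 1)) := by
    refine (lintegral_rpow_le_interpolate hwm.enorm hs.le hsp).trans (mul_le_mul' ?_ ?_)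
    · exact ENNReal.rpow_le_rpow (φ.lintegral_enorm_sub_convolution_le hu hT)
        (div_nonneg (by linarith) hp1.le)
    · refine ENNReal.rpow_le_rpow ?_ (div_nonneg (by linarith) hp1.le)
      refine lintegral_enorm_rpow_le_of_eLpNorm_le hp.symm.ne_zero ?_
      refine (eLpNorm_sub_le hum hvc.aestronglyMeasurable ?_).trans (add_le_add ?_ ?_)
      · exact_mod_cast hp.symm.lt.le
      · exact (eLpNorm_le_of_lintegral_translate_sub_le hu hT hp).trans hA
      · exact (φ.eLpNorm_convolution_le hu hT hp).trans hA
  have hsup : ∫⁻ x, ‖v x‖ₑ ^ s ≤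
      (ENNReal.ofReal (1 / (volume : Measure (EuclideanSpace ℝ (Fin N))).real
        (closedBall 0 (r / 2))) * D) ^ (s - 1) * ∫⁻ x, ‖u x‖ₑ := by
    calc ∫⁻ x, ‖v x‖ₑ ^ s ≤ ∫⁻ x, (ENNReal.ofReal (1 / (volume : Measure
          (EuclideanSpace ℝ (Fin N))).real (closedBall 0 (r / 2))) * D) ^ (s - 1) * ‖v x‖ₑ := by
          refine lintegral_mono fun x => ?_
          calc ‖v x‖ₑ ^ s = ‖v x‖ₑ ^ (s - 1) * ‖v x‖ₑ := by
                conv_rhs => rw [← ENNReal.rpow_one ‖v x‖ₑ, ← ENNReal.rpow_mul, one_mul]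
                rw [← ENNReal.rpow_add_of_nonneg _ _ (by linarith) zero_le_one, sub_add_cancel]
            _ ≤ _ := by
                refine mul_le_mul_left (ENNReal.rpow_le_rpow ?_ (by linarith)) _
                exact (φ.enorm_convolution_le hrR x).trans (mul_le_mul_right (hD x) _)
      _ ≤ _ := by
          rw [lintegral_const_mul _ hvc.enorm.measurable]
          exact mul_le_mul_right (φ.lintegral_enorm_convolution_le hu) _
  calc ∫⁻ x, ‖u x‖ₑ ^ s
      ≤ ∫⁻ x, 2 ^ (s - 1) * (‖u x - v x‖ₑ ^ s + ‖v x‖ₑ ^ s) := by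
        refine lintegral_mono fun x => ?_
        refine le_trans (ENNReal.rpow_le_rpow ?_ (by linarith))
          (ENNReal.rpow_add_le_mul_rpow_add_rpow _ _ hs.le)
        simpa using enorm_add_le (u x - v x) (v x)
    _ = 2 ^ (s - 1) * ((∫⁻ x, ‖u x - v x‖ₑ ^ s) + ∫⁻ x, ‖v x‖ₑ ^ s) := by
        rw [lintegral_const_mul' _ _ (ENNReal.rpow_ne_top_of_nonneg (by linarith) (by simp)),
          lintegral_add_left' (hwm.enorm.pow_const s)]
    _ ≤ _ := mul_le_mul_right (add_le_add hsmooth hsup) _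

end Sobolev

lemma integrable_abs_rpow_of_eLpNorm_ne_top {α : Type*} [MeasurableSpace α] {μ : Measure α}
    {f : α → ℝ} (hf : Integrable f μ) {p : NNReal} (hfp : eLpNorm f p μ ≠ ⊤) {q : ℝ}
    (hq : 1 ≤ q) (hqp : q < p) : Integrable (fun x => |f x| ^ q) μ := by
  refine ⟨(hf.aestronglyMeasurable.norm.aemeasurable.pow_const q).aestronglyMeasurable, ?_⟩
  have hp : 0 < (p : ℝ) - 1 := by linarith
  have hp0 : p ≠ 0 := by rintro rfl; simp at hp; linarith
  have h1 : ∫⁻ x, ‖|f x| ^ q‖ₑ ∂μ = ∫⁻ x, ‖f x‖ₑ ^ q ∂μ := by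
    congr 1; ext x
    rw [Real.enorm_rpow_of_nonneg (abs_nonneg _) (by linarith), Real.enorm_abs]
  rw [HasFiniteIntegral, h1]
  refine (lintegral_rpow_le_interpolate hf.aestronglyMeasurable.enorm hq hqp).trans_lt ?_
  exact ENNReal.mul_lt_top
    (ENNReal.rpow_lt_top_of_nonneg (div_nonneg (by linarith) hp.le) hf.2.ne)
    (ENNReal.rpow_lt_top_of_nonneg (div_nonneg (by linarith) hp.le)
      ((lintegral_enorm_rpow_le_of_eLpNorm_le hp0 le_rfl).trans_lt
        (ENNReal.rpow_lt_top_of_nonneg p.coe_nonneg hfp)).ne)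

/-- Hölder's inequality on a set. -/
lemma setLIntegral_enorm_le_rpow {α : Type*} [MeasurableSpace α] {μ : Measure α}
    {f : α → ℝ} (hf : AEStronglyMeasurable f μ) (S : Set α) {q : ℝ} (hq : 1 ≤ q)
    (hfq : Integrable (fun x => |f x| ^ q) μ) :
    ∫⁻ x in S, ‖f x‖ₑ ∂μ ≤
      ENNReal.ofReal (∫ x in S, |f x| ^ q ∂μ) ^ q⁻¹ * μ S ^ (1 - q⁻¹) := by
  have hq0 : 0 < q := by linarith
  have h1 : ENNReal.ofReal (∫ x in S, |f x| ^ q ∂μ) = ∫⁻ x in S, ‖f x‖ₑ ^ q ∂μ := by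
    rw [ofReal_integral_eq_lintegral_ofReal hfq.integrableOn (.of_forall fun x => by positivity)]
    congr 1; ext x
    rw [← ENNReal.ofReal_rpow_of_nonneg (abs_nonneg _) hq0.le, ← Real.norm_eq_abs, ofReal_norm]
  rw [h1]
  refine le_trans (le_of_eq ?_) ((ENNReal.lintegral_mul_norm_pow_le (μ := μ.restrict S)
    (g := fun _ => 1)
    (hf.restrict.enorm.pow_const q) aemeasurable_const (inv_nonneg.2 hq0.le)
    (sub_nonneg.2 (inv_le_one_of_one_le₀ hq)) (by ring)).trans_eq (by simp))
  congr 1; ext x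
  rw [← ENNReal.rpow_mul, mul_inv_cancel₀ hq0.ne']
  simp

theorem lions_lemma_BV {N : ℕ} (hN : 2 ≤ N)
    (u : ℕ → EuclideanSpace ℝ (Fin N) → ℝ)
    (hbv : ∀ n, IsBV (u n)) (C : ℝ) (hbound : ∀ n, bvNorm (u n) ≤ C)
    (R q : ℝ) (hR : 0 < R) (hq : 1 ≤ q) (hq' : q < (N : ℝ) / ((N : ℝ) - 1))
    (hvanish : Tendsto (fun n => ⨆ y : EuclideanSpace ℝ (Fin N),
        ∫ x in Metric.ball y R, |u n x| ^ q) atTop (nhds 0)) :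
    ∀ s : ℝ, 1 < s → s < (N : ℝ) / ((N : ℝ) - 1) →
      Tendsto (fun n => ∫ x, |u n x| ^ s) atTop (nhds 0) := by
  intro s hs hs'
  set p : NNReal := NNReal.conjExponent N
  have hp : NNReal.HolderConjugate N p :=
    NNReal.HolderConjugate.conjExponent (by exact_mod_cast hN)
  have hpN : (p : ℝ) = (N : ℝ) / ((N : ℝ) - 1) := by simpa using hp.coe.conjugate_eq
  rw [← hpN] at hq' hs'
  have hp1 : 0 < (p : ℝ) - 1 := by linarith
  set T : ENNReal := ENNReal.ofReal C with hTdef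
  have hL1 : ∀ n, ∫⁻ x, ‖u n x‖ₑ ≤ T := fun n => by
    rw [← ofReal_integral_norm_eq_lintegral_enorm (hbv n).1]
    refine ENNReal.ofReal_le_ofReal (le_trans ?_ (hbound n))
    exact le_add_of_nonneg_left (hbv n).totalVar_nonneg
  have hT : ∀ n h, ∫⁻ x, ‖u n (x + h) - u n x‖ₑ ≤ T * ‖h‖ₑ := fun n h => by
    have hi : Integrable (fun x => u n (x + h) - u n x) :=
      ((hbv n).1.comp_add_right h).sub (hbv n).1
    have hTV : totalVar (u n) ≤ C :=
      (le_add_of_nonneg_right (integral_nonneg fun x => abs_nonneg _)).trans (hbound n)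
    rw [← ofReal_integral_norm_eq_lintegral_enorm hi, ← ofReal_norm, hTdef,
      ← ENNReal.ofReal_mul ((hbv n).totalVar_nonneg.trans hTV)]
    exact ENNReal.ofReal_le_ofReal (((hbv n).integral_abs_translate_sub_le h).trans (by gcongr))
  set A : ENNReal :=
    eLpNormLESNormFDerivOneConst (volume : Measure (EuclideanSpace ℝ (Fin N))) p * (N * T)
  have hA : A ≠ ⊤ := ENNReal.mul_ne_top ENNReal.coe_ne_top
    (ENNReal.mul_ne_top (ENNReal.natCast_ne_top N) ENNReal.ofReal_ne_top)
  have hint : ∀ n (t : ℝ), 1 ≤ t → t < p → Integrable (fun x => |u n x| ^ t) := fun n t ht htp =>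
    integrable_abs_rpow_of_eLpNorm_ne_top (hbv n).1
      (ne_top_of_le_ne_top hA (eLpNorm_le_of_lintegral_translate_sub_le (hbv n).1 (hT n) hp)) ht htp
  set V : ENNReal := volume (ball (0 : EuclideanSpace ℝ (Fin N)) R) ^ (1 - q⁻¹)
  have hVtop : V ≠ ⊤ := ENNReal.rpow_ne_top_of_nonneg
    (sub_nonneg.2 (inv_le_one_of_one_le₀ hq)) measure_ball_lt_top.ne
  set D : ℕ → ENNReal := fun n =>
    ENNReal.ofReal (⨆ y, ∫ x in ball y R, |u n x| ^ q) ^ q⁻¹ * V with hDdef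
  have hD : ∀ n y, ∫⁻ x in ball y R, ‖u n x‖ₑ ≤ D n := fun n y => by
    refine (setLIntegral_enorm_le_rpow (hbv n).1.aestronglyMeasurable _ hq
      (hint n q hq hq')).trans ?_
    rw [Measure.addHaar_ball_center]
    refine mul_le_mul_left (ENNReal.rpow_le_rpow (ENNReal.ofReal_le_ofReal ?_) (by positivity)) _
    refine le_ciSup (f := fun y => ∫ x in ball y R, |u n x| ^ q)
      ⟨∫ x, |u n x| ^ q, ?_⟩ y
    rintro _ ⟨z, rfl⟩
    exact setIntegral_le_integral (hint n q hq hq') (.of_forall fun x => by positivity)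
  have hDlim : Tendsto D atTop (nhds 0) := by
    have h1 := (ENNReal.tendsto_ofReal hvanish).ennrpow_const q⁻¹
    rw [ENNReal.ofReal_zero, ENNReal.zero_rpow_of_pos (by positivity)] at h1
    simpa using ENNReal.Tendsto.mul_const h1 (.inr hVtop)
  have hc2 : (2 : ENNReal) ^ (s - 1) ≠ ⊤ := ENNReal.rpow_ne_top_of_nonneg (by linarith) (by simp)
  set B : ENNReal := ((A + A) ^ (p : ℝ)) ^ ((s - 1) / ((p : ℝ) - 1))
  have hB : B ≠ ⊤ := ENNReal.rpow_ne_top_of_nonneg (div_nonneg (by linarith) hp1.le)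
    (ENNReal.rpow_ne_top_of_nonneg p.coe_nonneg (ENNReal.add_ne_top.2 ⟨hA, hA⟩))
  have hsmall : Tendsto (fun r : ℝ => 2 ^ (s - 1) *
      ((T * ENNReal.ofReal r) ^ (((p : ℝ) - s) / ((p : ℝ) - 1)) * B)) (nhds 0) (nhds 0) := by
    have h1 : Tendsto (fun r : ℝ => T * ENNReal.ofReal r) (nhds 0) (nhds 0) := by
      have h0 := ENNReal.Tendsto.const_mul (ENNReal.tendsto_ofReal (tendsto_id (x := nhds (0 : ℝ))))
        (.inr (ENNReal.ofReal_ne_top : T ≠ ⊤))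
      rwa [ENNReal.ofReal_zero, mul_zero] at h0
    have h2 := h1.ennrpow_const (((p : ℝ) - s) / ((p : ℝ) - 1))
    rw [ENNReal.zero_rpow_of_pos (div_pos (by linarith) hp1)] at h2
    have h3 := ENNReal.Tendsto.mul_const h2 (.inr hB)
    rw [zero_mul] at h3
    simpa using ENNReal.Tendsto.const_mul h3 (.inr hc2)
  have hlim : Tendsto (fun n => ∫⁻ x, ‖u n x‖ₑ ^ s) atTop (nhds 0) := by
    rw [ENNReal.tendsto_nhds_zero]
    intro ε hε
    have hε2 : 0 < ε / 2 := ENNReal.half_pos hε.ne'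
    obtain ⟨r, hrε, hr, hrR⟩ := (((ENNReal.tendsto_nhds_zero.1 hsmall _ hε2).filter_mono
      nhdsWithin_le_nhds).and (Ioc_mem_nhdsGT hR)).exists
    set K : ENNReal := ENNReal.ofReal (1 / (volume : Measure (EuclideanSpace ℝ (Fin N))).real
      (closedBall 0 (r / 2)))
    have hlocal : Tendsto (fun n => 2 ^ (s - 1) * ((K * D n) ^ (s - 1) * T)) atTop (nhds 0) := by
      have h1 := ENNReal.Tendsto.const_mul hDlim (.inr (ENNReal.ofReal_ne_top : K ≠ ⊤))
      rw [mul_zero] at h1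
      have h2 := h1.ennrpow_const (s - 1)
      rw [ENNReal.zero_rpow_of_pos (by linarith)] at h2
      have h3 := ENNReal.Tendsto.mul_const h2 (.inr (ENNReal.ofReal_ne_top : T ≠ ⊤))
      rw [zero_mul] at h3
      have h4 := ENNReal.Tendsto.const_mul h3 (.inr hc2)
      rwa [mul_zero] at h4
    filter_upwards [ENNReal.tendsto_nhds_zero.1 hlocal _ hε2] with n hn
    refine (lintegral_rpow_le_of_lintegral_ball_le (hbv n).1 (hT n) hp hs hs' hr hrR le_rfl
      (hD n)).trans ?_
    rw [mul_add, ← ENNReal.add_halves ε]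
    exact add_le_add hrε (le_trans (by gcongr; exact hL1 n) hn)
  have hreal : ∀ n, ∫ x, |u n x| ^ s = (∫⁻ x, ‖u n x‖ₑ ^ s).toReal := fun n => by
    rw [integral_eq_lintegral_of_nonneg_ae (.of_forall fun x => by positivity)
      (hint n s hs.le hs').aestronglyMeasurable]
    congr 2; ext x
    rw [← ENNReal.ofReal_rpow_of_nonneg (abs_nonneg _) (by linarith), ← Real.norm_eq_abs,
      ofReal_norm]
  simp_rw [hreal]
  exact (ENNReal.tendsto_toReal ENNReal.zero_ne_top).comp hlim
end
end

section
/- (Mountain Pass Theorem without Palais-Smale) Let E be a Banach space, Φ = I₀ - I where I ∈ C¹(E,ℝ) and I₀ is locally Lipschitz and convex. Assume: (i) there exist ρ > 0 and α > Φ(0) with Φ(x) ≥ α for all ‖x‖ = ρ; (ii) Φ(e) < Φ(0) for some e with ‖e‖ > ρ. Define c = inf_{γ ∈ Γ} sup_{t ∈ [0,1]} Φ(γ(t)), where Γ = {γ ∈ C([0,1], E): γ(0) = 0, γ(1) = e}. Then c ≥ α, and for every ε > 0 there exists x_ε ∈ E with c - ε < Φ(x_ε) < c + ε and I₀(y) -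 I₀(x_ε) ≥ I'(x_ε)(y - x_ε) - ε‖y - x_ε‖ for all y ∈ E. -/
open Set Filter Topology

/-- The Ekeland variational principle, in its weak form. -/
theorem exists_forall_lt_add_mul_dist {X : Type*} [MetricSpace X] [CompleteSpace X] {f : X → ℝ}
    (hf : LowerSemicontinuous f) (hb : BddBelow (range f)) {δ : ℝ} (hδ : 0 < δ) (x₀ : X) :
    ∃ x, f x ≤ f x₀ ∧ ∀ y, y ≠ x → f x < f y + δ * dist x y := by
  let S : X → Set X := fun x => {y | f y + δ * dist x y ≤ f x}
  have hself : ∀ x, x ∈ S x := fun x => by simp [S]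
  have htrans : ∀ {x y z}, y ∈ S x → z ∈ S y → z ∈ S x := by
    intro x y z hy hz
    simp only [S, mem_ofPred_eq] at hy hz ⊢
    nlinarith [dist_triangle x y z]
  have hle : ∀ {x y}, y ∈ S x → f y ≤ f x := by
    intro x y hy
    simp only [S, mem_ofPred_eq] at hy
    nlinarith [dist_nonneg (x := x) (y := y)]
  have hclosed : ∀ x, IsClosed (S x) := fun x =>
    (hf.add (Continuous.lowerSemicontinuous (by fun_prop :
      Continuous fun y => δ * dist x y))).isClosed_preimage (f x)
  have hnext : ∀ (n : ℕ) (x : X), ∃ y ∈ S x, ∀ z ∈ S x, f y ≤ f z + (1 / 2) ^ n := by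
    intro n x
    have hbS : BddBelow (f '' S x) := hb.mono (image_subset_range _ _)
    obtain ⟨_, ⟨y, hy, rfl⟩, hlt⟩ := exists_lt_of_csInf_lt ((nonempty_of_mem (hself x)).image f)
      (lt_add_of_pos_right (sInf (f '' S x)) (by positivity : (0 : ℝ) < (1 / 2) ^ n))
    exact ⟨y, hy, fun z hz => by linarith [csInf_le hbS (mem_image_of_mem f hz)]⟩
  choose next hnextS hnextf using hnext
  let u : ℕ → X := fun n => Nat.rec x₀ next n
  have hu : ∀ n m, n ≤ m → u m ∈ S (u n) := by
    intro n m h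
    induction m, h using Nat.le_induction with
    | base => exact hself _
    | succ m _ ih => exact htrans ih (hnextS m (u m))
  have hsmall : ∀ n, ∀ z ∈ S (u (n + 1)), dist (u (n + 1)) z ≤ (1 / 2) ^ n / δ := by
    intro n z hz
    have h := hnextf n (u n) z (htrans (hu n (n + 1) n.le_succ) hz)
    rw [le_div_iff₀ hδ]
    have hz' : f z + δ * dist (u (n + 1)) z ≤ f (u (n + 1)) := hz
    change f (u (n + 1)) ≤ _ at h
    linarith
  have hlim : Tendsto (fun n : ℕ => ((1 : ℝ) / 2) ^ n / δ) atTop (𝓝 0) := by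
    simpa using (tendsto_pow_atTop_nhds_zero_of_lt_one (by norm_num : (0 : ℝ) ≤ 1 / 2)
      (by norm_num)).div_const δ
  have hcauchy : CauchySeq fun n => u (n + 1) :=
    cauchySeq_of_le_tendsto_0' _ (fun n m h => hsmall n _ (hu _ _ (Nat.succ_le_succ h))) hlim
  obtain ⟨x, hx⟩ := cauchySeq_tendsto_of_complete hcauchy
  have hxS : ∀ n, x ∈ S (u n) := fun n =>
    (hclosed _).mem_of_tendsto hx ((eventually_ge_atTop n).mono fun m hm =>
      hu _ _ (Nat.le_succ_of_le hm))
  refine ⟨x, hle (hxS 0), fun y hy => ?_⟩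
  by_contra! hyS
  refine hy (tendsto_nhds_unique ?_ hx)
  exact tendsto_iff_dist_tendsto_zero.2 (squeeze_zero (fun _ => dist_nonneg)
    (fun n => hsmall n y (htrans (hxS (n + 1)) hyS)) hlim)

section Descent

variable {E : Type*} [NormedAddCommGroup E] [NormedSpace ℝ E]

/-- Directions in the unit ball along which `f - L` decreases from `x` with slope more than `ε`. -/
def descentDirections (f : E → ℝ) (L : E →L[ℝ] ℝ) (ε : ℝ) (x : E) : Set E :=
  {w | ‖w‖ ≤ 1 ∧ ∃ τ : ℝ, 0 < τ ∧ f (x + τ • w) - f x - τ * L w < -(ε * τ)}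

theorem ConvexOn.sub_le_div_mul_sub {f : E → ℝ} (hf : ConvexOn ℝ univ f) (x w : E) {s τ : ℝ}
    (hs : 0 ≤ s) (hτ : 0 < τ) (hsτ : s ≤ τ) :
    f (x + s • w) - f x ≤ s / τ * (f (x + τ • w) - f x) := by
  have h := hf.2 (mem_univ x) (mem_univ (x + τ • w))
    (sub_nonneg.2 ((div_le_one hτ).2 hsτ)) (div_nonneg hs hτ.le) (by ring)
  have hx : (1 - s / τ) • x + (s / τ) • (x + τ • w) = x + s • w := by
    rw [smul_add, smul_smul, div_mul_cancel₀ _ hτ.ne']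
    module
  rw [hx] at h
  simp only [smul_eq_mul] at h
  linarith

theorem descent_of_le {f : E → ℝ} (hf : ConvexOn ℝ univ f) (L : E →L[ℝ] ℝ) {ε : ℝ} {x w : E}
    {s τ : ℝ} (hs : 0 < s) (hsτ : s ≤ τ) (h : f (x + τ • w) - f x - τ * L w < -(ε * τ)) :
    f (x + s • w) - f x - s * L w < -(ε * s) := by
  have hτ : 0 < τ := hs.trans_le hsτ
  have h₁ := hf.sub_le_div_mul_sub x w hs.le hτ hsτ
  have h₂ : s / τ * (f (x + τ • w) - f x) < s / τ * (τ * L w - ε * τ) :=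
    mul_lt_mul_of_pos_left (by linarith) (div_pos hs hτ)
  have h₃ : s / τ * (τ * L w - ε * τ) = s * L w - ε * s := by
    field_simp
  linarith

theorem descentDirections_nonempty {f : E → ℝ} {L : E →L[ℝ] ℝ} {ε : ℝ} {x y : E}
    (h : f y - f x < L (y - x) - ε * ‖y - x‖) : (descentDirections f L ε x).Nonempty := by
  have hne : y - x ≠ 0 := by
    intro h0
    obtain rfl : y = x := sub_eq_zero.1 h0
    simp at h
  have hpos : 0 < ‖y - x‖ := norm_pos_iff.2 hne
  have hw : ‖y - x‖ • (‖y - x‖⁻¹ • (y - x)) = y - x := by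
    rw [smul_smul, mul_inv_cancel₀ hpos.ne', one_smul]
  refine ⟨‖y - x‖⁻¹ • (y - x), (norm_smul_inv_norm (𝕜 := ℝ) hne).le, ‖y - x‖, hpos, ?_⟩
  rw [← smul_eq_mul, ← map_smul, hw, add_sub_cancel]
  linarith

theorem convex_descentDirections {f : E → ℝ} (hf : ConvexOn ℝ univ f) (L : E →L[ℝ] ℝ) (ε : ℝ)
    (x : E) : Convex ℝ (descentDirections f L ε x) := by
  rintro w₁ ⟨hw₁, τ₁, hτ₁, h₁⟩ w₂ ⟨hw₂, τ₂, hτ₂, h₂⟩ a b ha hb hab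
  have hτ : 0 < min τ₁ τ₂ := lt_min hτ₁ hτ₂
  have hball : Convex ℝ {w : E | ‖w‖ ≤ 1} := by
    simpa [Metric.closedBall, dist_zero_right] using convex_closedBall (0 : E) 1
  refine ⟨hball hw₁ hw₂ ha hb hab, min τ₁ τ₂, hτ, ?_⟩
  replace h₁ := descent_of_le hf L hτ (min_le_left _ _) h₁
  replace h₂ := descent_of_le hf L hτ (min_le_right _ _) h₂
  generalize min τ₁ τ₂ = τ at *
  have h := hf.2 (mem_univ (x + τ • w₁)) (mem_univ (x + τ • w₂)) ha hb hab
  have hx : a • (x + τ • w₁) + b • (x + τ • w₂) = x + τ • (a • w₁ + b • w₂) := by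
    have : x = (a + b) • x := by rw [hab, one_smul]
    nth_rw 3 [this]
    module
  rw [hx] at h
  simp only [smul_eq_mul, map_add, map_smul] at h ⊢
  obtain rfl : b = 1 - a := by linarith
  rcases ha.eq_or_lt with rfl | ha'
  · linarith
  · nlinarith

theorem eventually_mem_descentDirections {f : E → ℝ} (hf : Continuous f) {L : E → E →L[ℝ] ℝ}
    (hL : Continuous L) {ε : ℝ} {x w : E} (h : w ∈ descentDirections f (L x) ε x) :
    ∀ᶠ x' in 𝓝 x, w ∈ descentDirections f (L x') ε x' := by
  obtain ⟨hw, τ, hτ, hlt⟩ := h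
  have hc : Continuous fun x' => f (x' + τ • w) - f x' - τ * L x' w := by fun_prop
  filter_upwards [hc.continuousAt.eventually_lt_const hlt] with x' hx'
  exact ⟨hw, τ, hτ, hx'⟩

theorem eventually_sub_le_of_mem_descentDirections {f g : E → ℝ} (hf : ConvexOn ℝ univ f)
    (hfc : Continuous f) {L : E →L[ℝ] ℝ} {x₀ w₀ : E} (hg : HasStrictFDerivAt g L x₀)
    {ε δ : ℝ} (hδ : δ < ε) (h : w₀ ∈ descentDirections f L ε x₀) :
    ∀ᶠ z : ℝ × E × E in 𝓝 (0, x₀, w₀), 0 < z.1 → ‖z.2.2‖ ≤ 1 →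
      f (z.2.1 + z.1 • z.2.2) - g (z.2.1 + z.1 • z.2.2) <
        f z.2.1 - g z.2.1 - δ * z.1 := by
  obtain ⟨-, τ, hτ, hlt⟩ := h
  have hslope : ∀ᶠ z : ℝ × E × E in 𝓝 (0, x₀, w₀),
      f (z.2.1 + τ • z.2.2) - f z.2.1 - τ * L z.2.2 < -(ε * τ) := by
    have hc : Continuous fun z : ℝ × E × E =>
        f (z.2.1 + τ • z.2.2) - f z.2.1 - τ * L z.2.2 := by fun_prop
    exact hc.continuousAt.eventually_lt_const hlt
  have hsmall : ∀ᶠ z : ℝ × E × E in 𝓝 (0, x₀, w₀), z.1 < τ :=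
    continuous_fst.continuousAt.eventually_lt_const hτ
  have htend : Tendsto (fun z : ℝ × E × E => (z.2.1 + z.1 • z.2.2, z.2.1)) (𝓝 (0, x₀, w₀))
      (𝓝 (x₀, x₀)) := by
    have : Continuous fun z : ℝ × E × E => (z.2.1 + z.1 • z.2.2, z.2.1) := by fun_prop
    simpa using this.tendsto (0, x₀, w₀)
  have hgrad := htend.eventually (hg.isLittleO.def (sub_pos.2 hδ))
  filter_upwards [hslope, hsmall, hgrad] with ⟨s, x, w⟩ h₁ h₂ h₃ hs hw
  simp only at h₁ h₂ h₃ hs hw ⊢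
  replace h₁ := descent_of_le hf L hs h₂.le h₁
  rw [add_sub_cancel_left, map_smul, smul_eq_mul, norm_smul, Real.norm_of_nonneg hs.le,
    Real.norm_eq_abs] at h₃
  have h₄ : (ε - δ) * (s * ‖w‖) ≤ (ε - δ) * s :=
    mul_le_mul_of_nonneg_left (mul_le_of_le_one_right hs.le hw) (sub_pos.2 hδ).le
  linarith [(abs_le.1 h₃).1]

end Descent

section Path

variable {E : Type*} [NormedAddCommGroup E]

theorem bddAbove_range_comp_path {Φ : E → ℝ} (hΦ : Continuous Φ) (γ : C(unitInterval, E)) :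
    BddAbove (range fun t => Φ (γ t)) :=
  (isCompact_range (by fun_prop)).bddAbove

theorem lowerSemicontinuous_iSup_comp_path {Φ : E → ℝ} (hΦ : Continuous Φ) :
    LowerSemicontinuous fun γ : C(unitInterval, E) => ⨆ t, Φ (γ t) :=
  lowerSemicontinuous_ciSup (bddAbove_range_comp_path hΦ) fun t =>
    (hΦ.comp (continuous_eval_const t)).lowerSemicontinuous

/-- A path whose endpoints lie below its maximum can be pushed down linearly in the size of the
perturbation if there is a descent direction at each of its maximum points. -/
theorem exists_path_lt_sub_mul [NormedSpace ℝ E] {f g : E → ℝ} (hf : ConvexOn ℝ univ f)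
    (hfc : Continuous f) {g' : E → E →L[ℝ] ℝ} (hg : ∀ x, HasFDerivAt g (g' x) x) (hg' : Continuous g')
    {ε δ : ℝ} (hδε : δ < ε) {γ : C(unitInterval, E)} {m : ℝ}
    (hm : ∀ t, f (γ t) - g (γ t) ≤ m) (h0 : f (γ 0) - g (γ 0) < m)
    (h1 : f (γ 1) - g (γ 1) < m)
    (hdesc : ∀ t, f (γ t) - g (γ t) = m → (descentDirections f (g' (γ t)) ε (γ t)).Nonempty) :
    ∃ s > 0, ∃ η : C(unitInterval, E), η 0 = γ 0 ∧ η 1 = γ 1 ∧ dist γ η ≤ s ∧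
      ∀ t, f (η t) - g (η t) < m - δ * s := by
  have hgc : Continuous g := continuous_iff_continuousAt.2 fun x => (hg x).continuousAt
  have hΦγ : Continuous fun t => f (γ t) - g (γ t) := by fun_prop
  let W : unitInterval → Set E := fun t =>
    {w | ‖w‖ ≤ 1 ∧ (t = 0 ∨ t = 1 → w = 0) ∧
      (f (γ t) - g (γ t) = m → w ∈ descentDirections f (g' (γ t)) ε (γ t))}
  have hW : ∀ t, Convex ℝ (W t) := by
    rintro t w₁ ⟨hw₁, hz₁, hd₁⟩ w₂ ⟨hw₂, hz₂, hd₂⟩ a b ha hb hab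
    refine ⟨?_, fun ht => by simp [hz₁ ht, hz₂ ht],
      fun ht => convex_descentDirections hf _ _ _ (hd₁ ht) (hd₂ ht) ha hb hab⟩
    simpa using convex_closedBall (0 : E) 1 (by simpa using hw₁) (by simpa using hw₂) ha hb hab
  have hloc : ∀ t, ∃ w, ∀ᶠ t' in 𝓝 t, w ∈ W t' := by
    intro t
    rcases (hm t).lt_or_eq with ht | ht
    · refine ⟨0, (hΦγ.continuousAt.eventually_lt_const ht).mono fun t' ht' => ?_⟩
      exact ⟨by simp, fun _ => rfl, fun h => absurd h ht'.ne⟩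
    · obtain ⟨w, hw⟩ := hdesc t ht
      have ht0 : t ≠ 0 := by rintro rfl; exact h0.ne ht
      have ht1 : t ≠ 1 := by rintro rfl; exact h1.ne ht
      refine ⟨w, ?_⟩
      filter_upwards [isOpen_ne.mem_nhds ht0, isOpen_ne.mem_nhds ht1,
        (γ.continuous.tendsto t).eventually (eventually_mem_descentDirections hfc hg' hw)]
        with t' h0' h1' hd
      exact ⟨hw.1, fun h => (h.elim h0' h1').elim, fun _ => hd⟩
  obtain ⟨w, hw⟩ := exists_continuous_forall_mem_convex_of_local_const hW hloc
  have hpush : ∀ᶠ s : ℝ in 𝓝 0, ∀ t ∈ (univ : Set unitInterval), 0 < s →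
      f (γ t + s • w t) - g (γ t + s • w t) < m - δ * s := by
    refine isCompact_univ.eventually_forall_of_forall_eventually fun t _ => ?_
    rcases (hm t).lt_or_eq with ht | ht
    · have hc : Continuous fun z : ℝ × unitInterval =>
          f (γ z.2 + z.1 • w z.2) - g (γ z.2 + z.1 • w z.2) + δ * z.1 := by fun_prop
      have h := hc.continuousAt (x := (0, t)).eventually_lt_const (u := m) (by simpa using ht)
      exact h.mono fun z hz _ => by linarith
    · have hstrict : HasStrictFDerivAt g (g' (γ t)) (γ t) :=
        hasStrictFDerivAt_of_hasFDerivAt_of_continuousAt (Eventually.of_forall hg)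
          hg'.continuousAt
      have hc : Continuous fun z : ℝ × unitInterval => (z.1, γ z.2, w z.2) := by fun_prop
      filter_upwards [(hc.tendsto (0, t)).eventually
        (eventually_sub_le_of_mem_descentDirections hf hfc hstrict hδε ((hw t).2.2 ht))]
        with z hz hs
      linarith [hz hs (hw z.2).1, hm z.2]
  obtain ⟨s, hs, hs0⟩ := ((hpush.filter_mono nhdsWithin_le_nhds).and
    (self_mem_nhdsWithin : Ioi (0 : ℝ) ∈ 𝓝[>] 0)).exists
  refine ⟨s, hs0, γ + s • w, ?_, ?_, ?_, fun t => hs t (mem_univ t) hs0⟩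
  · simp [(hw 0).2.1 (Or.inl rfl)]
  · simp [(hw 1).2.1 (Or.inr rfl)]
  · refine (ContinuousMap.dist_le hs0.le).2 fun t => ?_
    simp only [ContinuousMap.add_apply, ContinuousMap.smul_apply, dist_self_add_right, norm_smul,
      Real.norm_of_nonneg hs0.le]
    exact mul_le_of_le_one_right hs0.le (hw t).1

theorem exists_norm_eq_of_path {γ : C(unitInterval, E)} {ρ : ℝ} (hρ : 0 ≤ ρ) (h0 : γ 0 = 0)
    (h1 : ρ ≤ ‖γ 1‖) : ∃ t, ‖γ t‖ = ρ :=
  mem_range_of_exists_le_of_exists_ge (by fun_prop : Continuous fun t => ‖γ t‖)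
    ⟨0, by simpa [h0] using hρ⟩ ⟨1, h1⟩

theorem iInf_path_eq (Φ : E → ℝ) (e : E) :
    (⨅ γ : {γ : C(ℝ, E) // γ 0 = 0 ∧ γ 1 = e}, ⨆ t : Icc (0 : ℝ) 1, Φ (γ.1 t.1)) =
      ⨅ γ : {γ : C(unitInterval, E) // γ 0 = 0 ∧ γ 1 = e}, ⨆ t, Φ (γ.1 t) := by
  refine Function.Surjective.iInf_congr
    (fun γ => ⟨γ.1.restrict (Icc 0 1), by simpa using γ.2⟩) ?_ fun γ => rfl
  rintro ⟨γ, h0, h1⟩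
  refine ⟨⟨ContinuousMap.IccExtend zero_le_one γ, ?_, ?_⟩, ?_⟩
  · simpa using h0
  · simpa using h1
  · ext t
    simp

end Path

theorem mountain_pass_without_PS {E : Type*} [NormedAddCommGroup E] [NormedSpace ℝ E]
    [CompleteSpace E]
    (I₀ : E → ℝ) (hconv : ConvexOn ℝ Set.univ I₀) (hlip : LocallyLipschitz I₀)
    (I : E → ℝ) (I' : E → E →L[ℝ] ℝ) (hI : ∀ x, HasFDerivAt I (I' x) x)
    (hI'cont : Continuous I')
    (Φ : E → ℝ) (hΦ : Φ = fun x => I₀ x - I x)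
    (ρ α : ℝ) (hρ : 0 < ρ) (hα : Φ 0 < α)
    (hsphere : ∀ x : E, ‖x‖ = ρ → α ≤ Φ x)
    (e : E) (he : ρ < ‖e‖) (hvalley : Φ e < Φ 0)
    (c : ℝ)
    (hc : c = ⨅ γ : {γ : C(ℝ, E) // γ 0 = 0 ∧ γ 1 = e},
        ⨆ t : Set.Icc (0 : ℝ) 1, Φ (γ.1 t.1)) :
    α ≤ c ∧ ∀ ε : ℝ, 0 < ε → ∃ xε : E,
      c - ε < Φ xε ∧ Φ xε < c + ε ∧
      ∀ y : E, I₀ y - I₀ xε ≥ (I' xε) (y - xε) - ε * ‖y - xε‖ := by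
  subst hΦ
  have hIc : Continuous I := continuous_iff_continuousAt.2 fun x => (hI x).continuousAt
  have hΦc : Continuous fun x => I₀ x - I x := hlip.continuous.sub hIc
  replace hc := hc.trans (iInf_path_eq (fun x => I₀ x - I x) e)
  set F : C(unitInterval, E) → ℝ := fun γ => ⨆ t, (I₀ (γ t) - I (γ t))
  let Γ : Set C(unitInterval, E) := {γ | γ 0 = 0 ∧ γ 1 = e}
  have hΓ : IsClosed Γ :=
    (isClosed_eq (continuous_eval_const 0) continuous_const).inter
      (isClosed_eq (continuous_eval_const 1) continuous_const)
  have : CompleteSpace Γ := hΓ.completeSpace_coe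
  have : Nonempty Γ := ⟨⟨⟨fun t => (t : ℝ) • e, by fun_prop⟩, by simp [Γ]⟩⟩
  have hle : ∀ (γ : C(unitInterval, E)) t, I₀ (γ t) - I (γ t) ≤ F γ := fun γ t =>
    le_ciSup (bddAbove_range_comp_path hΦc γ) t
  have hαF : ∀ γ : Γ, α ≤ F γ := by
    rintro ⟨γ, h0, h1⟩
    obtain ⟨t, ht⟩ := exists_norm_eq_of_path hρ.le h0 (by rw [h1]; exact he.le)
    exact (hsphere _ ht).trans (hle γ t)
  have hbdd : BddBelow (range fun γ : Γ => F γ) := ⟨α, by rintro _ ⟨γ, rfl⟩; exact hαF γ⟩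
  change c = ⨅ γ : Γ, F γ at hc
  refine ⟨hc.ge.trans' (le_ciInf hαF), fun ε hε => ?_⟩
  by_contra! hbad
  obtain ⟨γ₀, hγ₀⟩ := exists_lt_of_ciInf_lt (hc.ge.trans_lt (lt_add_of_pos_right c hε))
  obtain ⟨γ, hγγ₀, hγ⟩ := exists_forall_lt_add_mul_dist
    ((lowerSemicontinuous_iSup_comp_path hΦc).comp continuous_subtype_val) hbdd (half_pos hε) γ₀
  change F γ ≤ F γ₀ at hγγ₀
  have hcγ : c ≤ F γ := hc.le.trans (ciInf_le hbdd γ)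
  obtain ⟨s, hs, η, hη0, hη1, hdist, hη⟩ := exists_path_lt_sub_mul hconv hlip.continuous hI hI'cont
    (half_lt_self hε) (hle γ)
    (by rw [γ.2.1]; exact hα.trans_le (hαF γ))
    (by rw [γ.2.2]; exact (hvalley.trans hα).trans_le (hαF γ)) fun t ht => by
      obtain ⟨y, hy⟩ := hbad (γ.1 t) (by rw [ht]; linarith) (by rw [ht]; linarith)
      exact descentDirections_nonempty hy
  have hFη : F η ≤ F γ - ε / 2 * s := ciSup_le fun t => (hη t).le
  have hlt := hγ ⟨η, hη0.trans γ.2.1, hη1.trans γ.2.2⟩ (by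
    intro h
    have hηγ : η = γ.1 := congrArg Subtype.val h
    rw [hηγ] at hFη
    linarith [mul_pos (half_pos hε) hs])
  have hd : ε / 2 * dist γ.1 η ≤ ε / 2 * s := mul_le_mul_of_nonneg_left hdist (half_pos hε).le
  change F γ < F η + ε / 2 * dist γ.1 η at hlt
  linarith
end
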